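/- If weights are degree-monotone in a generating tuple ⟨μ,d⟩, then every directed Huffman tree H ∈ ℛℋ(μ,d) is a proper tree, i.e., every component of f(H) is at most μ̄/2. -/

import Mathlib

open scoped Classical
noncomputable section

/-- A directed tree on a finite vertex set `V`: each vertex has an outbound arc to its
`parent`, the `root` is a fixed point of `parent` (i.e. has no genuine outbound arc), and
every vertex reaches the root by iterating `parent`. -/
structure DirTree (V : Type) [Fintype V] [DecidableEq V] where
  root : V
  parent : V → V
  parent_root : parent root = root
  reaches : ∀ v, ∃ n, parent^[n] v = root

variable {V : Type} [Fintype V] [DecidableEq V]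

namespace DirTree

/-- `u` belongs to the subordinate group of `v`: there is a directed path from `u` to `v`. -/
def Desc (T : DirTree V) (u v : V) : Prop := ∃ n, T.parent^[n] u = v

/-- The set of vertices with an arc to `v`. -/
def children (T : DirTree V) (v : V) : Finset V :=
  Finset.univ.filter fun u => T.parent u = v ∧ u ≠ v

/-- Weight `f_T(v)` of the subordinate group of `v`. -/
def f (T : DirTree V) (μ : V → ℝ) (v : V) : ℝ :=
  ∑ u ∈ Finset.univ.filter (fun u => T.Desc u v), μ u

/-- Degree of `v` in the underlying undirected tree. -/
def deg (T : DirTree V) (v : V) : ℕ :=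
  (T.children v).card + (if v = T.root then 0 else 1)

/-- The underlying undirected tree. -/
def toGraph (T : DirTree V) : SimpleGraph V :=
  SimpleGraph.fromRel fun u v => T.parent u = v ∧ u ≠ v

/-- The vector (as a multiset, i.e. up to ascending rearrangement) of subordinate
groups' weights of internal non-root vertices. -/
def fvec (T : DirTree V) (μ : V → ℝ) : Multiset ℝ :=
  (Finset.univ.filter fun m => 1 < T.deg m ∧ m ≠ T.root).val.map (T.f μ)

end DirTree

/-- Degree of a vertex in a simple graph. -/
def gdeg (G : SimpleGraph V) (v : V) : ℕ :=
  (Finset.univ.filter fun u => G.Adj v u).card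

/-- `⟨μ, d⟩` is a generating tuple: nonnegative weights, degrees at least 1 summing to
`2(|V|-1)`, at least two pendent and at least one internal vertex. -/
structure IsGenTuple (μ : V → ℝ) (d : V → ℕ) : Prop where
  nonneg : ∀ v, 0 ≤ μ v
  deg_pos : ∀ v, 1 ≤ d v
  sum_deg : ∑ v, d v = 2 * (Fintype.card V - 1)
  two_le_pendent : 2 ≤ (Finset.univ.filter fun v => d v = 1).card
  one_le_internal : 1 ≤ (Finset.univ.filter fun v => 1 < d v).card

/-- Weights are degree-monotone in `⟨μ, d⟩`. -/
def DegMonotone (μ : V → ℝ) (d : V → ℕ) : Prop :=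
  (∀ m m', 1 < d m → 1 < d m' → d m < d m' → μ m ≤ μ m') ∧
  ∀ v, d v = 1 → 0 < μ v

/-- `T ∈ ℛ(μ,d)`: directed tree with internal root whose (undirected) degrees match `d`. -/
def memR (T : DirTree V) (d : V → ℕ) : Prop :=
  1 < d T.root ∧ ∀ v, T.deg v = d v

/-- `G ∈ 𝒯(μ,d)`: `G` is a tree whose degrees match `d`. -/
def memT (G : SimpleGraph V) (d : V → ℕ) : Prop :=
  G.IsTree ∧ ∀ v, gdeg G v = d v

/-- Vertex-weighted Wiener index. -/
def VWWI (μ : V → ℝ) (G : SimpleGraph V) : ℝ :=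
  (1 / 2) * ∑ u, ∑ v, μ u * μ v * (G.dist u v : ℝ)

/-- `S = (m, L)` is a minimal star for the state `(U, μ, d)`: the center `m` is an
internal vertex of `U` of least degree among internal vertices of least weight, and the
`d m - 1` leaves `L` are pendent vertices of `U` of least weights. -/
def IsMinimalStar (U : Finset V) (μ : V → ℝ) (d : V → ℕ) (m : V) (L : Finset V) : Prop :=
  m ∈ U ∧ 1 < d m ∧ L ⊆ U ∧ m ∉ L ∧ L.card = d m - 1 ∧
  (∀ v ∈ L, d v = 1) ∧
  (∀ m' ∈ U, 1 < d m' → μ m ≤ μ m') ∧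
  (∀ m' ∈ U, 1 < d m' → μ m' = μ m → d m ≤ d m') ∧
  ∀ u ∈ L, ∀ w ∈ U, d w = 1 → w ∉ L → μ u ≤ μ w

/-- Centers used before step `i` (0-indexed). -/
def usedCenters {q : ℕ} (c : Fin q → V) (i : ℕ) : Finset V :=
  (Finset.univ.filter fun j : Fin q => (j : ℕ) < i).image c

/-- Vertex set `V_{i+1}` of the state of the Huffman algorithm before (0-indexed) step `i`,
for the candidate Huffman tree `T` with star centers `c`. -/
def stateV (T : DirTree V) {q : ℕ} (c : Fin q → V) (i : ℕ) : Finset V :=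
  Finset.univ \ (Finset.univ.filter fun j : Fin q => (j : ℕ) < i).biUnion fun j => T.children (c j)

/-- Weight function `μ^{i+1}` of the state before (0-indexed) step `i`. -/
def stateMu (T : DirTree V) (μ : V → ℝ) {q : ℕ} (c : Fin q → V) (i : ℕ) : V → ℝ :=
  fun v => if v ∈ usedCenters c i then T.f μ v else μ v

/-- Degree function `d^{i+1}` of the state before (0-indexed) step `i`. -/
def stateD (d : V → ℕ) {q : ℕ} (c : Fin q → V) (i : ℕ) : V → ℕ :=
  fun v => if v ∈ usedCenters c i then 1 else d v

/-- `T` is a directed Huffman tree for `⟨μ, d⟩` whose star sequence has centers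
`c 0, …, c (q-1)` (so `S_i` has leaf set `children (c i)`): the centers enumerate the
internal vertices, the root is the last center, and at each of the first `q - 1` steps
the corresponding star is a minimal star of the current state. -/
def IsHuffmanSeq (μ : V → ℝ) (d : V → ℕ) (T : DirTree V) {q : ℕ} (c : Fin q → V) : Prop :=
  (∀ v, T.deg v = d v) ∧
  Function.Injective c ∧
  (∀ v, 1 < d v ↔ ∃ j, c j = v) ∧
  (∀ hq : 0 < q, T.root = c ⟨q - 1, Nat.sub_lt hq Nat.one_pos⟩) ∧
  ∀ i : Fin q, (i : ℕ) < q - 1 →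
    IsMinimalStar (stateV T c (i : ℕ)) (stateMu T μ c (i : ℕ)) (stateD d c (i : ℕ))
      (c i) (T.children (c i))

/-- `T ∈ ℛℋ(μ,d)`: `T` is a directed Huffman tree for `⟨μ, d⟩`. -/
def IsHuffmanDir (μ : V → ℝ) (d : V → ℕ) (T : DirTree V) : Prop :=
  ∃ (q : ℕ) (c : Fin q → V), IsHuffmanSeq μ d T c

/-- Sum of the `k` smallest components of a multiset of reals. -/
def ascSum (s : Multiset ℝ) (k : ℕ) : ℝ := ((s.sort (· ≤ ·)).take k).sum

/-- `x` weakly majorizes `y` (`y ⪯^w x`). -/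
def WMaj (x y : Multiset ℝ) : Prop :=
  Multiset.card x = Multiset.card y ∧ ∀ k, ascSum x k ≤ ascSum y k

/-- `x` strictly weakly majorizes `y` (`y ≺^w x`). -/
def SWMaj (x y : Multiset ℝ) : Prop := WMaj x y ∧ x ≠ y

namespace DirTree

lemma mem_children (T : DirTree V) {u v : V} :
    u ∈ T.children v ↔ T.parent u = v ∧ u ≠ v := by
  simp [children]

lemma iterate_parent_root (T : DirTree V) (n : ℕ) : T.parent^[n] T.root = T.root :=
  Function.iterate_fixed T.parent_root n

lemma eq_root_of_iterate_eq_self (T : DirTree V) {v : V} {n : ℕ} (hn : 0 < n)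
    (h : T.parent^[n] v = v) : v = T.root := by
  obtain ⟨k, hk⟩ := T.reaches v
  have h1 : T.parent^[n * k] v = v := by
    rw [Function.iterate_mul]
    exact Function.iterate_fixed h k
  have hle : k ≤ n * k := Nat.le_mul_of_pos_left k hn
  rw [← Nat.sub_add_cancel hle, Function.iterate_add_apply, hk, iterate_parent_root] at h1
  exact h1.symm

lemma not_desc_of_mem_children (T : DirTree V) {v w : V} (hw : w ∈ T.children v) :
    ¬ T.Desc v w := by
  rintro ⟨n, hn⟩
  obtain ⟨hp, hne⟩ := T.mem_children.1 hw
  have hv : v = T.root := by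
    apply T.eq_root_of_iterate_eq_self (n := n + 1) (Nat.succ_pos n)
    rw [Function.iterate_succ_apply', hn, hp]
  subst hv
  rw [iterate_parent_root] at hn
  exact hne hn.symm

lemma eq_of_desc_children (T : DirTree V) {u v w w' : V} (hw : w ∈ T.children v)
    (hw' : w' ∈ T.children v) (h : T.Desc u w) (h' : T.Desc u w') : w = w' := by
  obtain ⟨n, hn⟩ := h
  obtain ⟨n', hn'⟩ := h'
  wlog hle : n ≤ n' generalizing w w' n n'
  · exact (this hw' hw n' hn' n hn (by omega)).symm
  obtain ⟨t, rfl⟩ := Nat.exists_eq_add_of_le' hle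
  rw [Function.iterate_add_apply, hn] at hn'
  cases t with
  | zero => exact hn'
  | succ t =>
    rw [Function.iterate_succ_apply, (T.mem_children.1 hw).1] at hn'
    exact absurd ⟨t, hn'⟩ (T.not_desc_of_mem_children hw')

lemma desc_iff (T : DirTree V) (u v : V) :
    T.Desc u v ↔ u = v ∨ ∃ w ∈ T.children v, T.Desc u w := by
  constructor
  · rintro ⟨n, hn⟩
    induction n with
    | zero => exact Or.inl hn
    | succ n ih =>
      by_cases h : T.parent^[n] u = v
      · exact ih h
      · refine Or.inr ⟨T.parent^[n] u, T.mem_children.2 ⟨?_, h⟩, n, rfl⟩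
        rwa [Function.iterate_succ_apply'] at hn
  · rintro (rfl | ⟨w, hw, n, hn⟩)
    · exact ⟨0, rfl⟩
    · refine ⟨n + 1, ?_⟩
      rw [Function.iterate_succ_apply', hn, (T.mem_children.1 hw).1]

lemma f_eq (T : DirTree V) (μ : V → ℝ) (v : V) :
    T.f μ v = μ v + ∑ w ∈ T.children v, T.f μ w := by
  have hset : (Finset.univ.filter fun u => T.Desc u v) =
      insert v ((T.children v).biUnion fun w => Finset.univ.filter fun u => T.Desc u w) := by
    ext u
    simp [T.desc_iff u v]
  rw [f, hset, Finset.sum_insert, Finset.sum_biUnion]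
  · rfl
  · intro w hw w' hw' hne
    refine Finset.disjoint_left.2 fun u hu hu' => hne ?_
    simp only [Finset.mem_filter, Finset.mem_univ, true_and] at hu hu'
    exact T.eq_of_desc_children hw hw' hu hu'
  · simp only [Finset.mem_biUnion, Finset.mem_filter, Finset.mem_univ, true_and, not_exists,
      not_and]
    exact fun w hw => T.not_desc_of_mem_children hw

lemma f_nonneg (T : DirTree V) {μ : V → ℝ} (hμ : ∀ v, 0 ≤ μ v) (v : V) : 0 ≤ T.f μ v :=
  Finset.sum_nonneg fun u _ => hμ u

lemma sum_f_le_of_subset_children (T : DirTree V) {μ : V → ℝ} (hμ : ∀ v, 0 ≤ μ v) {v : V}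
    {S : Finset V} (hS : S ⊆ T.children v) : μ v + ∑ w ∈ S, T.f μ w ≤ T.f μ v := by
  rw [T.f_eq μ v]
  gcongr
  exact fun w _ _ => T.f_nonneg hμ w

lemma f_le_of_mem_children (T : DirTree V) {μ : V → ℝ} (hμ : ∀ v, 0 ≤ μ v) {v w : V}
    (hw : w ∈ T.children v) : T.f μ w ≤ T.f μ v := by
  have h := T.sum_f_le_of_subset_children hμ (Finset.singleton_subset_iff.2 hw)
  rw [Finset.sum_singleton] at h
  linarith [hμ v]

lemma f_root (T : DirTree V) (μ : V → ℝ) : T.f μ T.root = ∑ v, μ v := by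
  rw [f, Finset.filter_true_of_mem]
  exact fun v _ => T.reaches v

/-- To bound the subordinate weights of non-root vertices, it suffices to bound those of the
children of the root. -/
lemma f_le_of_forall_mem_children_root (T : DirTree V) {μ : V → ℝ} (hμ : ∀ v, 0 ≤ μ v) {a : ℝ}
    {P : V → Prop} (hP : ∀ v w, P w → w ∈ T.children v → P v)
    (h : ∀ w ∈ T.children T.root, P w → T.f μ w ≤ a) {w : V} (hw : w ≠ T.root) (hPw : P w) :
    T.f μ w ≤ a := by
  obtain ⟨n, hn⟩ := T.reaches w
  induction n generalizing w with
  | zero => exact absurd hn hw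
  | succ n ih =>
    have hc : w ∈ T.children (T.parent w) := T.mem_children.2
      ⟨rfl, fun he => hw (T.eq_root_of_iterate_eq_self Nat.one_pos he.symm)⟩
    by_cases hr : T.parent w = T.root
    · exact h w (hr ▸ hc) hPw
    · exact (T.f_le_of_mem_children hμ hc).trans (ih hr (hP _ _ hPw hc) hn)

end DirTree

/-- If every value of `f` on `s` is at most every value of `g` on the at least as large set `t`,
where `g` is nonnegative, then the sum of `f` over `s` is at most that of `g` over `t`. -/
lemma sum_le_sum_of_forall_le {ι : Type*} {s t : Finset ι} {f g : ι → ℝ}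
    (hcard : s.card ≤ t.card) (hg : ∀ w ∈ t, 0 ≤ g w) (h : ∀ u ∈ s, ∀ w ∈ t, f u ≤ g w) :
    ∑ u ∈ s, f u ≤ ∑ w ∈ t, g w := by
  rcases s.eq_empty_or_nonempty with rfl | hs
  · simpa using Finset.sum_nonneg hg
  obtain ⟨u₀, hu₀, hmax⟩ := s.exists_max_image f hs
  obtain ⟨t', ht', hc⟩ := Finset.exists_subset_card_eq hcard
  calc ∑ u ∈ s, f u ≤ s.card • f u₀ := Finset.sum_le_card_nsmul s f _ hmax
    _ = t'.card • f u₀ := by rw [hc]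
    _ ≤ ∑ w ∈ t', g w := Finset.card_nsmul_le_sum t' g _ fun w hw => h u₀ hu₀ w (ht' hw)
    _ ≤ ∑ w ∈ t, g w := Finset.sum_le_sum_of_subset_of_nonneg ht' fun w hw _ => hg w hw

lemma mem_usedCenters {W : Type} [DecidableEq W] {q : ℕ} {c : Fin q → W} {i : ℕ} {v : W} :
    v ∈ usedCenters c i ↔ ∃ j : Fin q, (j : ℕ) < i ∧ c j = v := by
  simp [usedCenters]

lemma mem_stateV {T : DirTree V} {q : ℕ} {c : Fin q → V} {i : ℕ} {v : V} :
    v ∈ stateV T c i ↔ ∀ j : Fin q, (j : ℕ) < i → v ∉ T.children (c j) := by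
  simp [stateV]

namespace IsHuffmanSeq

variable {μ : V → ℝ} {d : V → ℕ} {T : DirTree V} {q : ℕ} {c : Fin q → V}

lemma injective (h : IsHuffmanSeq μ d T c) : Function.Injective c := h.2.1

lemma one_lt_iff (h : IsHuffmanSeq μ d T c) {v : V} : 1 < d v ↔ ∃ j, c j = v := h.2.2.1 v

lemma one_lt (h : IsHuffmanSeq μ d T c) (j : Fin q) : 1 < d (c j) := h.one_lt_iff.2 ⟨j, rfl⟩

lemma isMinimalStar (h : IsHuffmanSeq μ d T c) {i j : Fin q} (hij : i < j) :
    IsMinimalStar (stateV T c (i : ℕ)) (stateMu T μ c (i : ℕ)) (stateD d c (i : ℕ))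
      (c i) (T.children (c i)) :=
  h.2.2.2.2 i (by have := j.2; have : (i : ℕ) < j := hij; omega)

lemma exists_center_eq_root (h : IsHuffmanSeq μ d T c) (i : Fin q) :
    ∃ r : Fin q, T.root = c r ∧ ∀ j, j ≤ r := by
  have hq : 0 < q := i.pos
  exact ⟨_, h.2.2.2.1 hq, fun j => Fin.le_def.2 (Nat.le_sub_one_of_lt j.2)⟩

lemma center_notMem_usedCenters (h : IsHuffmanSeq μ d T c) {i j : Fin q} (hij : i ≤ j) :
    c j ∉ usedCenters c i := by
  rw [mem_usedCenters]
  rintro ⟨l, hl, he⟩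
  rw [h.injective he] at hl
  exact absurd hl (not_lt.2 hij)

lemma lt_of_mem_children (h : IsHuffmanSeq μ d T c) {i j : Fin q}
    (hij : c i ∈ T.children (c j)) : i < j := by
  obtain ⟨r, -, hr⟩ := h.exists_center_eq_root j
  rcases (hr j).eq_or_lt with rfl | hj
  · exact lt_of_le_of_ne (hr i) fun he => (T.mem_children.1 hij).2 (he ▸ rfl)
  · have h1 := (h.isMinimalStar hj).2.2.2.2.2.1 _ hij
    by_contra hlt
    rw [stateD, if_neg (h.center_notMem_usedCenters (not_lt.1 hlt))] at h1
    exact (h.one_lt i).ne' h1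

lemma center_mem_stateV (h : IsHuffmanSeq μ d T c) {i j : Fin q} (hij : i ≤ j) :
    c j ∈ stateV T c i :=
  mem_stateV.2 fun _ hl hc => absurd ((h.lt_of_mem_children hc).trans hl) (not_lt.2 hij)

lemma weight_le (h : IsHuffmanSeq μ d T c) {i j : Fin q} (hij : i < j) :
    μ (c i) ≤ μ (c j) := by
  have hi := h.center_notMem_usedCenters (le_refl i)
  have hj := h.center_notMem_usedCenters hij.le
  have h1 := (h.isMinimalStar hij).2.2.2.2.2.2.1 (c j) (h.center_mem_stateV hij.le)
  simp only [stateD, stateMu, if_neg hi, if_neg hj] at h1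
  exact h1 (h.one_lt j)

lemma degree_le (h : IsHuffmanSeq μ d T c) (hmono : DegMonotone μ d) {i j : Fin q}
    (hij : i < j) : d (c i) ≤ d (c j) := by
  by_contra! hlt
  have hi := h.center_notMem_usedCenters (le_refl i)
  have hj := h.center_notMem_usedCenters hij.le
  have h1 := (h.isMinimalStar hij).2.2.2.2.2.2.2.1 (c j) (h.center_mem_stateV hij.le)
  simp only [stateD, stateMu, if_neg hi, if_neg hj] at h1
  exact hlt.not_ge (h1 (h.one_lt j)
    ((hmono.1 _ _ (h.one_lt j) (h.one_lt i) hlt).antisymm (h.weight_le hij)))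

lemma card_children_of_lt (h : IsHuffmanSeq μ d T c) {i j : Fin q} (hij : i < j) :
    (T.children (c i)).card = d (c i) - 1 := by
  have h1 := (h.isMinimalStar hij).2.2.2.2.1
  rwa [stateD, if_neg (h.center_notMem_usedCenters (le_refl i))] at h1

lemma card_children_root (h : IsHuffmanSeq μ d T c) :
    (T.children T.root).card = d T.root := by
  simpa [DirTree.deg] using h.1 T.root

lemma le_card_children (h : IsHuffmanSeq μ d T c) (v : V) :
    d v - 1 ≤ (T.children v).card := by
  have h1 := h.1 v
  rw [DirTree.deg] at h1
  split_ifs at h1 <;> omega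

/-- A pendent vertex of a state carries the weight of its subordinate group. -/
lemma stateMu_eq_f (h : IsHuffmanSeq μ d T c) {i : Fin q} {w : V}
    (hw : stateD d c i w = 1) : stateMu T μ c i w = T.f μ w := by
  rw [stateMu]
  split_ifs with hu
  · rfl
  rw [stateD, if_neg hu] at hw
  have hr : w ≠ T.root := by
    rintro rfl
    obtain ⟨r, hr, -⟩ := h.exists_center_eq_root i
    exact (h.one_lt r).ne' (hr ▸ hw)
  have h1 := h.1 w
  rw [DirTree.deg, if_neg hr, hw] at h1
  have h2 : T.children w = ∅ := by
    rw [← Finset.card_eq_zero]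
    omega
  rw [T.f_eq, h2, Finset.sum_empty, add_zero]

/-- A star that is built later and has at least as many leaves, all of them pendent in
the earlier state, weighs at least as much. -/
lemma f_le_add_sum (h : IsHuffmanSeq μ d T c) (hgen : IsGenTuple μ d) {i j : Fin q}
    (hij : i < j) {S : Finset V} (hS : S ⊆ T.children (c j)) (hcard : d (c i) - 1 ≤ S.card)
    (hpend : ∀ l, c l ∈ S → l < i) : T.f μ (c i) ≤ μ (c j) + ∑ w ∈ S, T.f μ w := by
  have hstar := h.isMinimalStar hij
  rw [T.f_eq μ (c i)]
  refine add_le_add (h.weight_le hij) (sum_le_sum_of_forall_le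
    ((h.card_children_of_lt hij).trans_le hcard) (fun w _ => T.f_nonneg hgen.nonneg w) ?_)
  intro u hu w hw
  have hcj := (T.mem_children.1 (hS hw)).1
  have hother : ∀ l < j, w ∉ T.children (c l) := fun l hl hc =>
    hl.ne (h.injective ((T.mem_children.1 hc).1.symm.trans hcj))
  have hdw : stateD d c i w = 1 := by
    rw [stateD]
    split_ifs with hused
    · rfl
    · by_contra hne
      obtain ⟨l, rfl⟩ := h.one_lt_iff.1 (lt_of_le_of_ne (hgen.deg_pos w) (Ne.symm hne))
      exact hused (mem_usedCenters.2 ⟨l, hpend l hw, rfl⟩)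
  have h1 := hstar.2.2.2.2.2.2.2.2 u hu w
    (mem_stateV.2 fun l hl => hother l (lt_trans (Fin.lt_def.2 hl) hij)) hdw (hother i hij)
  rwa [h.stateMu_eq_f hdw,
    h.stateMu_eq_f (hstar.2.2.2.2.2.1 u hu)] at h1

/-- The stars of the Huffman algorithm are built in ascending order of weight. -/
lemma f_monotone (h : IsHuffmanSeq μ d T c) (hgen : IsGenTuple μ d) (hmono : DegMonotone μ d) :
    Monotone fun j => T.f μ (c j) := by
  intro i j
  induction j using WellFoundedLT.induction with
  | ind j ih =>
    intro hle
    rcases hle.eq_or_lt with rfl | hij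
    · exact le_rfl
    by_cases hpend : ∀ l, c l ∈ T.children (c j) → l < i
    · exact (h.f_le_add_sum hgen hij subset_rfl ((Nat.sub_le_sub_right
        (h.degree_le hmono hij) 1).trans (h.le_card_children _)) hpend).trans
        (T.f_eq μ (c j)).ge
    · push Not at hpend
      obtain ⟨l, hl, hil⟩ := hpend
      exact (ih l (h.lt_of_mem_children hl) hil).trans (T.f_le_of_mem_children hgen.nonneg hl)

lemma two_mul_f_le_of_mem_children_root (h : IsHuffmanSeq μ d T c) (hgen : IsGenTuple μ d)
    (hmono : DegMonotone μ d) {i : Fin q} (hi : c i ∈ T.children T.root) :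
    2 * T.f μ (c i) ≤ ∑ v, μ v := by
  obtain ⟨r, hr, -⟩ := h.exists_center_eq_root i
  have hir : i < r := h.lt_of_mem_children (hr ▸ hi)
  have hsum := Finset.add_sum_erase _ (T.f μ) hi
  have hroot := T.f_eq μ T.root
  rw [T.f_root] at hroot
  suffices T.f μ (c i) ≤ μ T.root + ∑ w ∈ (T.children T.root).erase (c i), T.f μ w by
    linarith
  by_cases hpend : ∀ l, c l ∈ (T.children T.root).erase (c i) → l < i
  · rw [hr] at hpend ⊢
    refine h.f_le_add_sum hgen hir (Finset.erase_subset _ _) ?_ hpend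
    rw [← hr, Finset.card_erase_of_mem hi, h.card_children_root, hr]
    exact Nat.sub_le_sub_right (h.degree_le hmono hir) 1
  · push Not at hpend
    obtain ⟨l, hl, hil⟩ := hpend
    have h1 := h.f_monotone hgen hmono hil
    have h2 := Finset.single_le_sum (fun w _ => T.f_nonneg hgen.nonneg w) hl
    linarith [hgen.nonneg T.root]

end IsHuffmanSeq

/-- under degree-monotone weights, every directed Huffman tree is proper:
each component of its vector of subordinate groups' weights is at most `μ̄/2`. -/
theorem huffman_is_proper {V : Type} [Fintype V] [DecidableEq V]
    (μ : V → ℝ) (d : V → ℕ) (hgen : IsGenTuple μ d) (hmono : DegMonotone μ d)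
    (H : DirTree V) (hH : IsHuffmanDir μ d H) :
    ∀ x ∈ H.fvec μ, x ≤ (∑ v, μ v) / 2 := by
  intro x hx
  obtain ⟨q, c, h⟩ := hH
  simp only [DirTree.fvec, Multiset.mem_map, Finset.mem_val, Finset.mem_filter,
    Finset.mem_univ, true_and] at hx
  obtain ⟨m, ⟨hm, hroot⟩, rfl⟩ := hx
  refine H.f_le_of_forall_mem_children_root hgen.nonneg (P := fun v => 1 < d v) ?_ ?_ hroot
    (h.1 m ▸ hm)
  · intro v w hw hc
    have hv := h.1 v
    have hpos := Finset.card_pos.2 ⟨w, hc⟩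
    rw [DirTree.deg] at hv
    split_ifs at hv with hvr
    · obtain ⟨j, -⟩ := h.one_lt_iff.1 hw
      obtain ⟨r, hr, -⟩ := h.exists_center_eq_root j
      rw [hvr, hr]
      exact h.one_lt r
    · omega
  · intro w hw hdw
    obtain ⟨i, rfl⟩ := h.one_lt_iff.1 hdw
    linarith [h.two_mul_f_le_of_mem_children_root hgen hmono hw]
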